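/- arXiv:2006.00469 — 9 statements merged into one kernel-verified Lean document; each statement's English description precedes it below -/
import Mathlib

section
/- Suppose a bipartite no-signalling experiment is given by finite nonempty sets S_A (Alice's settings), A (Alice's outcomes), T (Bob's settings), B (Bob's outcomes), a family of probability distributions p1(a|s) (p1(a|s) ≥ 0, ∑_{a∈A} p1(a|s) = 1 for each s ∈ S_A), and a family of probability distributions p2(b|t,s,a) (p2 ≥ 0, ∑_{b∈B} p2(b|t,s,a) = 1), defining joint statistics p(a,b|s,t) = p1(a|s)·p2(b|t,s,a). Suppose there exist a finite set Λ, functions μ(λ|s,a) ≥ 0 with ∑_{λ∈Λ} μ(λ|s,a) = 1, and functions ξ(b|t,λ) ≥ 0 with ∑_{b∈B} ξ(b|t,λ) = 1, such that p2(b|t,s,a) = ∑_{λ∈Λ} ξ(b|t,λ)·μ(λ|s,a) for all b,t,s,a, and such that the preparation-noncontextuality condition holds: there is a function ν : Λ → ℝ with ∑_{a∈A} p1(a|s)·μ(λ|s,a) = ν(λ) for every s ∈ S_A and λ ∈ Λ. Then the experiment admits a locally causal model: there exist functions α(a|s,λ) ≥ 0 with ∑_{a∈A} α(a|s,λ) =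 1 for all s,λ, such that p(a,b|s,t) = ∑_{λ∈Λ} ν(λ)·α(a|s,λ)·ξ(b|t,λ) for all a ∈ A, b ∈ B, s ∈ S_A, t ∈ T. -/
/-- Appendix A: preparation noncontextuality on one wing of a
bipartite no-signalling experiment implies a locally causal model. -/
theorem prep_noncontextuality_implies_locally_causal
    {SA A T B Λ : Type*} [Fintype SA] [Fintype A] [Fintype T] [Fintype B] [Fintype Λ]
    [Nonempty SA] [Nonempty A] [Nonempty T] [Nonempty B]
    (p1 : SA → A → ℝ) (p2 : T → SA → A → B → ℝ)
    (hp1 : ∀ s a, 0 ≤ p1 s a) (hp1sum : ∀ s, ∑ a, p1 s a = 1)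
    (hp2 : ∀ t s a b, 0 ≤ p2 t s a b) (hp2sum : ∀ t s a, ∑ b, p2 t s a b = 1)
    (μ : SA → A → Λ → ℝ) (ξ : T → Λ → B → ℝ) (ν : Λ → ℝ)
    (hμ : ∀ s a l, 0 ≤ μ s a l) (hμsum : ∀ s a, ∑ l, μ s a l = 1)
    (hξ : ∀ t l b, 0 ≤ ξ t l b) (hξsum : ∀ t l, ∑ b, ξ t l b = 1)
    (hmodel : ∀ b t s a, p2 t s a b = ∑ l, ξ t l b * μ s a l)
    (hPNC : ∀ s l, ∑ a, p1 s a * μ s a l = ν l) :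
    ∃ α : SA → Λ → A → ℝ,
      (∀ s l a, 0 ≤ α s l a) ∧ (∀ s l, ∑ a, α s l a = 1) ∧
      (∀ a b s t, p1 s a * p2 t s a b = ∑ l, ν l * α s l a * ξ t l b) := by
  have key : ∀ s l a, ν l * (if ν l = 0 then p1 s a else p1 s a * μ s a l / ν l)
      = p1 s a * μ s a l := by
    intro s l a
    split_ifs with h
    · have hzero := (Finset.sum_eq_zero_iff_of_nonneg
        fun a _ => mul_nonneg (hp1 s a) (hμ s a l)).1 ((hPNC s l).trans h)
      rw [h, zero_mul, hzero a (Finset.mem_univ a)]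
    · exact mul_div_cancel₀ _ h
  refine ⟨fun s l a => if ν l = 0 then p1 s a else p1 s a * μ s a l / ν l, ?_, ?_, ?_⟩
  · intro s l a
    have hν : 0 ≤ ν l :=
      hPNC s l ▸ Finset.sum_nonneg fun a _ => mul_nonneg (hp1 s a) (hμ s a l)
    dsimp only
    split_ifs
    · exact hp1 s a
    · exact div_nonneg (mul_nonneg (hp1 s a) (hμ s a l)) hν
  · intro s l
    by_cases h : ν l = 0
    · simpa only [h, if_true] using hp1sum s
    · simp only [h, if_false]
      rw [← Finset.sum_div, hPNC, div_self h]
  · intro a b s t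
    simp only [key]
    rw [hmodel, Finset.mul_sum]
    exact Finset.sum_congr rfl fun l _ => by ring
end

section
/- Let S := ∑_{m∈Msg} π(m) ∑_{x∈X, λ∈Λ} μ_m(x,λ) ∑_{y∈Y} N(y|x) ξ(m|y,λ) be the one-shot success probability of a preparation noncontextual strategy, where Λ is a finite set, for each m ∈ Msg the function μ_m : X × Λ → ℝ satisfies μ_m(x,λ) ≥ 0 and ∑_{x,λ} μ_m(x,λ) = 1, the λ-marginal ∑_{x∈X} μ_m(x,λ) = ν(λ) is the same function of λ for every m ∈ Msg (preparation noncontextuality), and ξ : Msg × Y × Λ → ℝ satisfies ξ(m'|y,λ) ≥ 0 and ∑_{m'∈Msg} ξ(m'|y,λ) = 1 for all y,λ. Then S ≤ S_Cl^max, the maximum over deterministic classical strategies. -/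
/-- For fixed decoding weights, some deterministic encoder and decoder do at least as well as any
subnormalized randomized encoders of common total weight `c`. -/
theorem exists_deterministic_strategy_ge
    {X Y Msg : Type*} [Fintype X] [Fintype Y] [Fintype Msg]
    [Nonempty X] [Nonempty Msg] [DecidableEq Msg]
    (N : X → Y → ℝ) (π : Msg → ℝ) (hπ : ∀ m, 0 ≤ π m)
    (w : Msg → X → ℝ) (hw : ∀ m x, 0 ≤ w m x) (c : ℝ) (hc : 0 ≤ c) (hwsum : ∀ m, ∑ x, w m x = c)
    (q : Msg → Y → ℝ) (hq : ∀ m y, 0 ≤ q m y) (hqsum : ∀ y, ∑ m, q m y = 1) :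
    ∃ (f : Msg → X) (g : Y → Msg),
      ∑ m, π m * ∑ x, w m x * ∑ y, N x y * q m y ≤
        c * ∑ m, π m * ∑ y, N (f m) y * (if g y = m then (1 : ℝ) else 0) := by
  choose f hf using fun m => Finite.exists_max fun x => ∑ y, N x y * q m y
  choose g hg using fun y => Finite.exists_max fun m => π m * N (f m) y
  refine ⟨f, g, ?_⟩
  calc ∑ m, π m * ∑ x, w m x * ∑ y, N x y * q m y
      ≤ ∑ m, π m * (c * ∑ y, N (f m) y * q m y) := by
        gcongr with m
        · exact hπ m
        · rw [← hwsum m, Finset.sum_mul]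
          exact Finset.sum_le_sum fun x _ => mul_le_mul_of_nonneg_left (hf m x) (hw m x)
    _ = c * ∑ y, ∑ m, q m y * (π m * N (f m) y) := by
        rw [Finset.sum_comm, Finset.mul_sum]
        refine Finset.sum_congr rfl fun m _ => ?_
        simp only [Finset.mul_sum]
        exact Finset.sum_congr rfl fun y _ => by ring
    _ ≤ c * ∑ y, π (g y) * N (f (g y)) y := by
        gcongr with y
        rw [← one_mul (π (g y) * N (f (g y)) y), ← hqsum y, Finset.sum_mul]
        exact Finset.sum_le_sum fun m _ => mul_le_mul_of_nonneg_left (hg y m) (hq m y)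
    _ = c * ∑ m, π m * ∑ y, N (f m) y * (if g y = m then (1 : ℝ) else 0) := by
        congr 1
        simp_rw [Finset.mul_sum]
        rw [Finset.sum_comm]
        simp

/-- the one-shot success probability of any preparation
noncontextual strategy is bounded by the maximum over deterministic classical
strategies. -/
theorem prep_noncontextual_success_le_classical
    {X Y Msg Λ : Type*} [Fintype X] [Fintype Y] [Fintype Msg] [Fintype Λ]
    [Nonempty X] [Nonempty Y] [Nonempty Msg]
    [DecidableEq Msg] [DecidableEq Y]
    (N : X → Y → ℝ) (hN : ∀ x y, 0 ≤ N x y) (hNsum : ∀ x, ∑ y, N x y = 1)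
    (π : Msg → ℝ) (hπ : ∀ m, 0 ≤ π m) (hπsum : ∑ m, π m = 1)
    (μ : Msg → X → Λ → ℝ) (ν : Λ → ℝ)
    (hμ : ∀ m x l, 0 ≤ μ m x l) (hμsum : ∀ m, ∑ x, ∑ l, μ m x l = 1)
    (hPNC : ∀ m l, ∑ x, μ m x l = ν l)
    (ξ : Msg → Y → Λ → ℝ) (hξ : ∀ m' y l, 0 ≤ ξ m' y l)
    (hξsum : ∀ y l, ∑ m', ξ m' y l = 1) :
    (∑ m, π m * ∑ x, ∑ l, μ m x l * ∑ y, N x y * ξ m y l)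
      ≤ Finset.univ.sup' Finset.univ_nonempty
          (fun fg : (Msg → X) × (Y → Msg) =>
            ∑ m, π m * ∑ y, N (fg.1 m) y * (if fg.2 y = m then (1 : ℝ) else 0)) := by
  set V := Finset.univ.sup' Finset.univ_nonempty
    (fun fg : (Msg → X) × (Y → Msg) =>
      ∑ m, π m * ∑ y, N (fg.1 m) y * (if fg.2 y = m then (1 : ℝ) else 0))
  obtain ⟨m₀⟩ := ‹Nonempty Msg›
  have hν : ∀ l, 0 ≤ ν l := fun l => hPNC m₀ l ▸ Finset.sum_nonneg fun x _ => hμ m₀ x l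
  have hνsum : ∑ l, ν l = 1 := by
    rw [← hμsum m₀, Finset.sum_comm]
    exact Finset.sum_congr rfl fun l _ => (hPNC m₀ l).symm
  calc (∑ m, π m * ∑ x, ∑ l, μ m x l * ∑ y, N x y * ξ m y l)
      = ∑ l, ∑ m, π m * ∑ x, μ m x l * ∑ y, N x y * ξ m y l := by
        rw [Finset.sum_comm]
        refine Finset.sum_congr rfl fun m _ => ?_
        rw [← Finset.mul_sum, Finset.sum_comm]
    _ ≤ ∑ l, ν l * V := by
        gcongr with l
        obtain ⟨f, g, h⟩ := exists_deterministic_strategy_ge N π hπ (fun m x => μ m x l)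
          (fun m x => hμ m x l) (ν l) (hν l) (fun m => hPNC m l) (fun m y => ξ m y l)
          (fun m y => hξ m y l) (fun y => hξsum y l)
        refine h.trans (mul_le_mul_of_nonneg_left ?_ (hν l))
        exact Finset.le_sup' (fun fg : (Msg → X) × (Y → Msg) =>
          ∑ m, π m * ∑ y, N (fg.1 m) y * (if fg.2 y = m then (1 : ℝ) else 0))
          (Finset.mem_univ (f, g))
    _ = V := by rw [← Finset.sum_mul, hνsum, one_mul]
end

section
/- For a k-regular output-uniform classical channel with uniform message prior, every behavior p that is no-signalling to Alice satisfies the affine relation S_Bell(p) = 1 − k/|Y| + (k/|Y|)·S(p) between the nonlocal-game value and the one-shot success probability. -/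
open Finset

/-- One-shot success probability `S(p)` for a `k`-regular output-uniform
channel `N` with uniform message prior:
`S(p) = (1/|Msg|) ∑_m ∑_x ∑_{y ∈ Y_x} (1/k) p(x,m|m,y)`.
Here `p m y x m'` denotes the behavior p(x,m'|m,y). -/
noncomputable def oneShotS {X Y Msg : Type*} [Fintype X] [Fintype Y] [Fintype Msg]
    (N : X → Y → ℝ) (k : ℕ) (p : Msg → Y → X → Msg → ℝ) : ℝ :=
  (1 / (Fintype.card Msg : ℝ)) *
    ∑ m, ∑ x, ∑ y ∈ Finset.univ.filter (fun y => N x y ≠ 0), (1 / (k : ℝ)) * p m y x m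

/-- The predicate `V(x,m',m,y)` of the nonlocal game: `1` if `y ∉ Y_x`, and
`[m = m']` if `y ∈ Y_x`. -/
noncomputable def gameV {X Y Msg : Type*} [DecidableEq Msg]
    (N : X → Y → ℝ) (x : X) (m' m : Msg) (y : Y) : ℝ :=
  if N x y ≠ 0 then (if m = m' then 1 else 0) else 1

/-- The nonlocal-game value `S_Bell(p)`. -/
noncomputable def sBell {X Y Msg : Type*} [Fintype X] [Fintype Y] [Fintype Msg]
    [DecidableEq Msg] (N : X → Y → ℝ) (p : Msg → Y → X → Msg → ℝ) : ℝ :=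
  (1 / ((Fintype.card Msg : ℝ) * (Fintype.card Y : ℝ))) *
    ∑ x, ∑ m', ∑ m, ∑ y, p m y x m' * gameV N x m' m y

/-- For fixed `x` and `m`, the no-signalling marginal `q` of `x` is collected at each of the
outputs outside the support of `x`. -/
theorem sum_mul_gameV {X Y Msg : Type*} [Fintype Y] [Fintype Msg] [DecidableEq Msg]
    (N : X → Y → ℝ) (x : X) (m : Msg) (f : Y → Msg → ℝ) (q : ℝ)
    (hq : ∀ y, ∑ m', f y m' = q) :
    ∑ m', ∑ y, f y m' * gameV N x m' m y =
      ((Fintype.card Y : ℝ) - ((Finset.univ.filter (fun y => N x y ≠ 0)).card : ℝ)) * q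
        + ∑ y ∈ Finset.univ.filter (fun y => N x y ≠ 0), f y m := by
  have hy : ∀ y, ∑ m', f y m' * gameV N x m' m y =
      q + ((if N x y ≠ 0 then f y m else 0) - if N x y ≠ 0 then q else 0) := by
    intro y
    by_cases h : N x y = 0
    · simp [gameV, h, hq]
    · simp [gameV, h]
  rw [Finset.sum_comm, Finset.sum_congr rfl fun y _ => hy y, Finset.sum_add_distrib,
    Finset.sum_sub_distrib, ← Finset.sum_filter, ← Finset.sum_filter]
  simp only [Finset.sum_const, nsmul_eq_mul, Finset.card_univ]
  ring

/-- for a `k`-regular output-uniform classical channel with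
uniform message prior, every behavior that is no-signalling to Alice satisfies
`S_Bell(p) = 1 - k/|Y| + (k/|Y|) S(p)`. -/
theorem sBell_affine_oneShotS
    {X Y Msg : Type*} [Fintype X] [Fintype Y] [Fintype Msg]
    [Nonempty X] [Nonempty Y] [Nonempty Msg] [DecidableEq Msg]
    (N : X → Y → ℝ) (hN : ∀ x y, 0 ≤ N x y) (hNsum : ∀ x, ∑ y, N x y = 1)
    (k : ℕ) (hk1 : 1 ≤ k) (hkY : k ≤ Fintype.card Y)
    (hreg : ∀ x, (Finset.univ.filter (fun y => N x y ≠ 0)).card = k)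
    (hunif : ∀ x y, N x y ≠ 0 → N x y = 1 / (k : ℝ))
    (p : Msg → Y → X → Msg → ℝ)
    (hp : ∀ m y x m', 0 ≤ p m y x m')
    (hpsum : ∀ m y, ∑ x, ∑ m', p m y x m' = 1)
    (hns : ∀ x m y y'', ∑ m', p m y x m' = ∑ m', p m y'' x m') :
    sBell N p = 1 - (k : ℝ) / (Fintype.card Y : ℝ)
      + ((k : ℝ) / (Fintype.card Y : ℝ)) * oneShotS N k p := by
  obtain ⟨y₀⟩ := ‹Nonempty Y›
  have hm : ∀ m, ∑ x, ∑ m', ∑ y, p m y x m' * gameV N x m' m y =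
      ((Fintype.card Y : ℝ) - k)
        + ∑ x, ∑ y ∈ Finset.univ.filter (fun y => N x y ≠ 0), p m y x m := by
    intro m
    rw [Finset.sum_congr rfl fun x _ => sum_mul_gameV N x m (fun y m' => p m y x m') _
      fun y => hns x m y y₀]
    simp only [hreg]
    rw [Finset.sum_add_distrib, ← Finset.mul_sum, hpsum, mul_one]
  have hswap : ∑ x, ∑ m', ∑ m, ∑ y, p m y x m' * gameV N x m' m y =
      ∑ m, ∑ x, ∑ m', ∑ y, p m y x m' * gameV N x m' m y := by
    rw [Finset.sum_comm (s := Finset.univ (α := Msg))]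
    exact Finset.sum_congr rfl fun x _ => Finset.sum_comm
  have hk : (k : ℝ) ≠ 0 := by positivity
  have hY : (Fintype.card Y : ℝ) ≠ 0 := by
    have := hk1.trans hkY
    positivity
  have hM : (Fintype.card Msg : ℝ) ≠ 0 := by
    exact_mod_cast Fintype.card_ne_zero
  unfold sBell oneShotS
  simp only [hswap, hm, ← Finset.mul_sum, Finset.sum_add_distrib, Finset.sum_const,
    nsmul_eq_mul, Finset.card_univ]
  field_simp
end

section
/- For a k-regular output-uniform classical channel with uniform message prior, every behavior p that is no-signalling to Alice satisfies: S(p) = 1 if and only if S_Bell(p) = 1. That is, one-shot zero-error communication is achieved if and only if the corresponding nonlocal game is won with certainty. -/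
open Finset

/-- The total probability weight of the events in which the output lies in the support of the
input and the decoded message is wrong. -/
noncomputable def errorWeight {X Y Msg : Type*} [Fintype X] [Fintype Y] [Fintype Msg]
    (N : X → Y → ℝ) (p : Msg → Y → X → Msg → ℝ) : ℝ :=
  ∑ m, ∑ x, ∑ y ∈ Finset.univ.filter (fun y => N x y ≠ 0), (∑ m', p m y x m' - p m y x m)

/-- For a behavior that is no-signalling to Alice on a channel with supports of size `k`, the
failure probability of one-shot communication is the error weight up to normalization. -/
theorem card_mul_one_sub_oneShotS {X Y Msg : Type*} [Fintype X] [Fintype Y] [Fintype Msg]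
    [Nonempty Y] [Nonempty Msg] (N : X → Y → ℝ) (k : ℕ) (hk : k ≠ 0)
    (hreg : ∀ x, (Finset.univ.filter (fun y => N x y ≠ 0)).card = k)
    (p : Msg → Y → X → Msg → ℝ)
    (hpsum : ∀ m y, ∑ x, ∑ m', p m y x m' = 1)
    (hns : ∀ x m y y'', ∑ m', p m y x m' = ∑ m', p m y'' x m') :
    (Fintype.card Msg : ℝ) * k * (1 - oneShotS N k p) = errorWeight N p := by
  have hM : (Fintype.card Msg : ℝ) ≠ 0 := by simp
  have hk' : (k : ℝ) ≠ 0 := by exact_mod_cast hk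
  obtain ⟨y₀⟩ := ‹Nonempty Y›
  have htotal : ∑ m, ∑ x, ∑ y ∈ Finset.univ.filter (fun y => N x y ≠ 0), ∑ m', p m y x m'
      = (Fintype.card Msg : ℝ) * k := by
    have hinner : ∀ m x, ∑ y ∈ Finset.univ.filter (fun y => N x y ≠ 0), ∑ m', p m y x m'
        = k * ∑ m', p m y₀ x m' := by
      intro m x
      rw [Finset.sum_congr rfl fun y _ => hns x m y y₀, Finset.sum_const, hreg, nsmul_eq_mul]
    simp_rw [hinner, ← Finset.mul_sum, hpsum]
    simp [mul_comm]
  simp only [errorWeight, oneShotS, Finset.sum_sub_distrib, ← Finset.mul_sum]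
  rw [htotal]
  field_simp

/-- The losing probability of the nonlocal game is the error weight up to normalization. -/
theorem card_mul_one_sub_sBell {X Y Msg : Type*} [Fintype X] [Fintype Y] [Fintype Msg]
    [Nonempty Y] [Nonempty Msg] [DecidableEq Msg] (N : X → Y → ℝ)
    (p : Msg → Y → X → Msg → ℝ)
    (hpsum : ∀ m y, ∑ x, ∑ m', p m y x m' = 1) :
    (Fintype.card Msg : ℝ) * Fintype.card Y * (1 - sBell N p) = errorWeight N p := by
  have hM : (Fintype.card Msg : ℝ) ≠ 0 := by simp
  have hY : (Fintype.card Y : ℝ) ≠ 0 := by simp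
  have hV : ∀ m x y, ∑ m', p m y x m' * gameV N x m' m y
      = ∑ m', p m y x m' - if N x y ≠ 0 then ∑ m', p m y x m' - p m y x m else 0 := by
    intro m x y
    by_cases h : N x y = 0 <;> simp [gameV, h]
  have hcomm : ∑ x, ∑ m', ∑ m, ∑ y, p m y x m' * gameV N x m' m y
      = ∑ m, ∑ x, ∑ y, ∑ m', p m y x m' * gameV N x m' m y := by
    rw [Finset.sum_comm (s := (Finset.univ : Finset Msg))]
    refine Finset.sum_congr rfl fun x _ => ?_
    rw [Finset.sum_comm]
    exact Finset.sum_congr rfl fun m _ => Finset.sum_comm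
  have htotal : ∑ m, ∑ x, ∑ y, ∑ m', p m y x m'
      = (Fintype.card Msg : ℝ) * Fintype.card Y := by
    rw [Finset.sum_congr rfl fun m _ => Finset.sum_comm]
    simp [hpsum]
  have hsum : ∑ x, ∑ m', ∑ m, ∑ y, p m y x m' * gameV N x m' m y
      = (Fintype.card Msg : ℝ) * Fintype.card Y - errorWeight N p := by
    rw [hcomm]
    simp_rw [hV, Finset.sum_sub_distrib (f := fun y => ∑ m', p _ y _ m'), ← Finset.sum_filter]
    simp_rw [Finset.sum_sub_distrib (f := fun x => ∑ y, ∑ m', p _ y x m')]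
    rw [Finset.sum_sub_distrib, htotal, errorWeight]
  rw [sBell, hsum]
  field_simp
  ring

/-- for a `k`-regular output-uniform classical channel with
uniform message prior, every behavior that is no-signalling to Alice achieves
one-shot zero-error communication iff it wins the corresponding nonlocal game
with certainty: `S(p) = 1 ↔ S_Bell(p) = 1`. -/
theorem oneShot_zero_error_iff_game_won
    {X Y Msg : Type*} [Fintype X] [Fintype Y] [Fintype Msg]
    [Nonempty X] [Nonempty Y] [Nonempty Msg] [DecidableEq Msg]
    (N : X → Y → ℝ) (hN : ∀ x y, 0 ≤ N x y) (hNsum : ∀ x, ∑ y, N x y = 1)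
    (k : ℕ) (hk1 : 1 ≤ k) (hkY : k ≤ Fintype.card Y)
    (hreg : ∀ x, (Finset.univ.filter (fun y => N x y ≠ 0)).card = k)
    (hunif : ∀ x y, N x y ≠ 0 → N x y = 1 / (k : ℝ))
    (p : Msg → Y → X → Msg → ℝ)
    (hp : ∀ m y x m', 0 ≤ p m y x m')
    (hpsum : ∀ m y, ∑ x, ∑ m', p m y x m' = 1)
    (hns : ∀ x m y y'', ∑ m', p m y x m' = ∑ m', p m y'' x m') :
    oneShotS N k p = 1 ↔ sBell N p = 1 := by
  have hk : k ≠ 0 := Nat.one_le_iff_ne_zero.mp hk1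
  have hMk : (Fintype.card Msg : ℝ) * k ≠ 0 := by simp [hk]
  have hMY : (Fintype.card Msg : ℝ) * Fintype.card Y ≠ 0 := by simp
  have hS := card_mul_one_sub_oneShotS N k hk hreg p hpsum hns
  have hB := card_mul_one_sub_sBell N p hpsum
  calc oneShotS N k p = 1 ↔ errorWeight N p = 0 := by
        rw [← hS, mul_eq_zero, or_iff_right hMk, sub_eq_zero, eq_comm]
    _ ↔ sBell N p = 1 := by
        rw [← hB, mul_eq_zero, or_iff_right hMY, sub_eq_zero, eq_comm]
end

section
/- For a k-regular output-uniform classical channel with uniform message prior, the maximal Bell-local value of the nonlocal game satisfies S_local^max := sup { S_Bell(p) : p a Bell-local behavior } = 1 − k/|Y| + (k/|Y|)·S_Cl^max, where S_Cl^max is the maximum over deterministic classical strategies of the one-shot success probability. -/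
open Finset

/-- A behavior `p m y x m'` (i.e. p(x,m'|m,y)) is Bell-local. -/
def BellLocal {X Y Msg : Type*} [Fintype X] [Fintype Y] [Fintype Msg]
    (p : Msg → Y → X → Msg → ℝ) : Prop :=
  ∃ (n : ℕ) (w : Fin n → ℝ) (a : Msg → Fin n → X → ℝ) (b : Y → Fin n → Msg → ℝ),
    (∀ l, 0 ≤ w l) ∧ (∑ l, w l = 1) ∧
    (∀ m l x, 0 ≤ a m l x) ∧ (∀ m l, ∑ x, a m l x = 1) ∧
    (∀ y l m', 0 ≤ b y l m') ∧ (∀ y l, ∑ m', b y l m' = 1) ∧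
    (∀ m y x m', p m y x m' = ∑ l, w l * a m l x * b y l m')

/-- The classical value `S_Cl^max` with uniform prior: the maximum over
deterministic encodings `f : Msg → X` and decodings `g : Y → Msg`. -/
noncomputable def sClMax {X Y Msg : Type*} [Fintype X] [Fintype Y] [Fintype Msg]
    [Nonempty X] [Nonempty Y] [Nonempty Msg] [DecidableEq Msg] [DecidableEq Y]
    (N : X → Y → ℝ) : ℝ :=
  Finset.univ.sup' Finset.univ_nonempty
    (fun fg : (Msg → X) × (Y → Msg) =>
      (1 / (Fintype.card Msg : ℝ)) *
        ∑ m, ∑ y, N (fg.1 m) y * (if fg.2 y = m then (1 : ℝ) else 0))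

/-- A weighted average of finitely many values is at most one of those values. -/
theorem exists_sum_mul_le {ι : Type*} [Fintype ι] [Nonempty ι] (a c : ι → ℝ)
    (ha : ∀ i, 0 ≤ a i) (hsum : ∑ i, a i = 1) : ∃ j, ∑ i, a i * c i ≤ c j := by
  obtain ⟨j, hj⟩ := Finite.exists_max c
  refine ⟨j, ?_⟩
  calc ∑ i, a i * c i ≤ ∑ i, a i * c j :=
        Finset.sum_le_sum fun i _ => mul_le_mul_of_nonneg_left (hj i) (ha i)
    _ = c j := by rw [← Finset.sum_mul, hsum, one_mul]

/-- Randomized encodings and decodings succeed with probability at most `sClMax N`. -/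
theorem success_le_sClMax {X Y Msg : Type*} [Fintype X] [Fintype Y] [Fintype Msg]
    [Nonempty X] [Nonempty Y] [Nonempty Msg] [DecidableEq Msg] [DecidableEq Y]
    (N : X → Y → ℝ) (a : Msg → X → ℝ) (b : Y → Msg → ℝ)
    (ha : ∀ m x, 0 ≤ a m x) (ha1 : ∀ m, ∑ x, a m x = 1)
    (hb : ∀ y m, 0 ≤ b y m) (hb1 : ∀ y, ∑ m, b y m = 1) :
    1 / (Fintype.card Msg : ℝ) * ∑ m, ∑ x, ∑ y, a m x * N x y * b y m
      ≤ sClMax (Msg := Msg) N := by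
  choose f hf using fun m =>
    exists_sum_mul_le (a m) (fun x => ∑ y, N x y * b y m) (ha m) (ha1 m)
  choose g hg using fun y => exists_sum_mul_le (b y) (fun m => N (f m) y) (hb y) (hb1 y)
  refine le_trans ?_ (Finset.le_sup' (fun fg : (Msg → X) × (Y → Msg) =>
      (1 / (Fintype.card Msg : ℝ)) *
        ∑ m, ∑ y, N (fg.1 m) y * (if fg.2 y = m then (1 : ℝ) else 0))
      (Finset.mem_univ (f, g)))
  refine mul_le_mul_of_nonneg_left ?_ (by positivity)
  calc ∑ m, ∑ x, ∑ y, a m x * N x y * b y m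
      ≤ ∑ m, ∑ y, N (f m) y * b y m := Finset.sum_le_sum fun m _ => by
        simpa only [Finset.mul_sum, mul_assoc] using hf m
    _ = ∑ y, ∑ m, b y m * N (f m) y := by
        rw [Finset.sum_comm]
        simp only [mul_comm]
    _ ≤ ∑ y, N (f (g y)) y := Finset.sum_le_sum fun y _ => hg y
    _ = ∑ m, ∑ y, N (f m) y * (if g y = m then (1 : ℝ) else 0) := by
        rw [Finset.sum_comm]
        simp

/-- The game value of a product behavior, in terms of its one-shot success probability. -/
theorem sBell_mul {X Y Msg : Type*} [Fintype X] [Fintype Y] [Fintype Msg]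
    [Nonempty Y] [Nonempty Msg] [DecidableEq Msg]
    (N : X → Y → ℝ) (hNsum : ∀ x, ∑ y, N x y = 1) (k : ℕ) (hk : k ≠ 0)
    (hunif : ∀ x y, N x y ≠ 0 → N x y = 1 / (k : ℝ))
    (a : Msg → X → ℝ) (b : Y → Msg → ℝ)
    (ha1 : ∀ m, ∑ x, a m x = 1) (hb1 : ∀ y, ∑ m, b y m = 1) :
    sBell N (fun m y x m' => a m x * b y m')
      = 1 - (k : ℝ) / (Fintype.card Y : ℝ) + ((k : ℝ) / (Fintype.card Y : ℝ)) *
        (1 / (Fintype.card Msg : ℝ) * ∑ m, ∑ x, ∑ y, a m x * N x y * b y m) := by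
  have hV : ∀ (x : X) (m' m : Msg) (y : Y),
      gameV N x m' m y = 1 - k * N x y + k * N x y * (if m = m' then 1 else 0) := by
    intro x m' m y
    by_cases h : N x y = 0
    · simp [gameV, h]
    · have : (k : ℝ) * N x y = 1 := by
        rw [hunif x y h]
        field_simp
      simp [gameV, h, this]
  have hdecode : ∀ m x y, ∑ m', a m x * b y m' * gameV N x m' m y
      = a m x - k * (a m x * N x y) + k * (a m x * N x y * b y m) := by
    intro m x y
    calc ∑ m', a m x * b y m' * gameV N x m' m y
        = ∑ m', (a m x * (1 - k * N x y) * b y m'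
            + if m = m' then k * (a m x * N x y * b y m') else 0) := by
          refine Finset.sum_congr rfl fun m' _ => ?_
          rw [hV]
          split_ifs <;> ring
      _ = a m x - k * (a m x * N x y) + k * (a m x * N x y * b y m) := by
          rw [Finset.sum_add_distrib, ← Finset.mul_sum, hb1, Finset.sum_ite_eq,
            if_pos (Finset.mem_univ m)]
          ring
  have hsum : ∑ x, ∑ m', ∑ m, ∑ y, a m x * b y m' * gameV N x m' m y
      = (Fintype.card Msg : ℝ) * Fintype.card Y - Fintype.card Msg * k
        + k * ∑ m, ∑ x, ∑ y, a m x * N x y * b y m := by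
    calc ∑ x, ∑ m', ∑ m, ∑ y, a m x * b y m' * gameV N x m' m y
        = ∑ m, ∑ x, ∑ y, ∑ m', a m x * b y m' * gameV N x m' m y := by
          rw [Finset.sum_comm (s := (Finset.univ : Finset Msg))]
          refine Finset.sum_congr rfl fun x _ => ?_
          rw [Finset.sum_comm]
          exact Finset.sum_congr rfl fun m _ => Finset.sum_comm
      _ = _ := by
          simp only [hdecode, Finset.sum_add_distrib, Finset.sum_sub_distrib, ← Finset.mul_sum,
            hNsum, ha1, mul_one, Finset.sum_const, Finset.card_univ, nsmul_eq_mul]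
  have hY : (Fintype.card Y : ℝ) ≠ 0 := by simp
  have hM : (Fintype.card Msg : ℝ) ≠ 0 := by simp
  rw [sBell, hsum]
  field_simp

/-- The game value is linear in the behavior. -/
theorem sBell_sum_mul {X Y Msg ι : Type*} [Fintype X] [Fintype Y] [Fintype Msg] [Fintype ι]
    [DecidableEq Msg] (N : X → Y → ℝ) (w : ι → ℝ) (p : ι → Msg → Y → X → Msg → ℝ) :
    sBell N (fun m y x m' => ∑ l, w l * p l m y x m') = ∑ l, w l * sBell N (p l) := by
  have h : ∀ l, w l * sBell N (p l) = ∑ x, ∑ m', ∑ m, ∑ y,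
      1 / ((Fintype.card Msg : ℝ) * Fintype.card Y)
        * (w l * p l m y x m' * gameV N x m' m y) := by
    intro l
    simp only [sBell, Finset.mul_sum]
    congr! 4
    ring
  simp_rw [h]
  rw [Finset.sum_comm, sBell, Finset.mul_sum]
  refine Finset.sum_congr rfl fun x _ => ?_
  rw [Finset.mul_sum, Finset.sum_comm]
  refine Finset.sum_congr rfl fun m' _ => ?_
  rw [Finset.mul_sum, Finset.sum_comm]
  refine Finset.sum_congr rfl fun m _ => ?_
  rw [Finset.mul_sum, Finset.sum_comm]
  refine Finset.sum_congr rfl fun y _ => ?_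
  rw [Finset.sum_mul, Finset.mul_sum]

/-- for a `k`-regular output-uniform classical channel with
uniform message prior, the maximal Bell-local value of the nonlocal game is
`S_local^max = 1 - k/|Y| + (k/|Y|) S_Cl^max`. -/
theorem sLocalMax_eq
    {X Y Msg : Type*} [Fintype X] [Fintype Y] [Fintype Msg]
    [Nonempty X] [Nonempty Y] [Nonempty Msg] [DecidableEq Msg] [DecidableEq Y]
    (N : X → Y → ℝ) (hN : ∀ x y, 0 ≤ N x y) (hNsum : ∀ x, ∑ y, N x y = 1)
    (k : ℕ) (hk1 : 1 ≤ k) (hkY : k ≤ Fintype.card Y)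
    (hreg : ∀ x, (Finset.univ.filter (fun y => N x y ≠ 0)).card = k)
    (hunif : ∀ x y, N x y ≠ 0 → N x y = 1 / (k : ℝ)) :
    sSup {s : ℝ | ∃ p : Msg → Y → X → Msg → ℝ, BellLocal p ∧ s = sBell N p}
      = 1 - (k : ℝ) / (Fintype.card Y : ℝ)
        + ((k : ℝ) / (Fintype.card Y : ℝ)) * sClMax (Msg := Msg) N := by
  classical
  have hk : k ≠ 0 := Nat.one_le_iff_ne_zero.mp hk1
  refine IsGreatest.csSup_eq ⟨?_, ?_⟩
  · obtain ⟨⟨f, g⟩, -, hfg⟩ := Finset.exists_mem_eq_sup' Finset.univ_nonempty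
      (fun fg : (Msg → X) × (Y → Msg) =>
        (1 / (Fintype.card Msg : ℝ)) *
          ∑ m, ∑ y, N (fg.1 m) y * (if fg.2 y = m then (1 : ℝ) else 0))
    refine ⟨fun m y x m' => (if f m = x then 1 else 0) * (if g y = m' then 1 else 0),
      ⟨1, fun _ => 1, fun m _ x => if f m = x then 1 else 0,
        fun y _ m' => if g y = m' then 1 else 0, by simp, by simp,
        fun m _ x => by positivity, by simp,
        fun y _ m' => by positivity, by simp, by simp⟩, ?_⟩
    rw [sBell_mul N hNsum k hk hunif (fun m x => if f m = x then 1 else 0)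
      (fun y m' => if g y = m' then 1 else 0) (by simp) (by simp), sClMax, hfg]
    congr 3
    refine Finset.sum_congr rfl fun m _ => ?_
    rw [Finset.sum_comm]
    exact Finset.sum_congr rfl fun y _ => by simp
  · rintro _ ⟨p, ⟨n, w, a, b, hw, hw1, ha, ha1, hb, hb1, hp⟩, rfl⟩
    have hp' : p = fun m y x m' => ∑ l, w l * (a m l x * b y l m') := by
      funext m y x m'
      simp only [hp, mul_assoc]
    rw [hp', sBell_sum_mul N w fun l m y x m' => a m l x * b y l m']
    calc ∑ l, w l * sBell N (fun m y x m' => a m l x * b y l m')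
        ≤ ∑ l, w l * (1 - (k : ℝ) / (Fintype.card Y : ℝ)
            + ((k : ℝ) / (Fintype.card Y : ℝ)) * sClMax (Msg := Msg) N) := by
          refine Finset.sum_le_sum fun l _ => mul_le_mul_of_nonneg_left ?_ (hw l)
          rw [sBell_mul N hNsum k hk hunif (fun m x => a m l x) (fun y m' => b y l m')
            (fun m => ha1 m l) (fun y => hb1 y l)]
          gcongr
          exact success_le_sClMax N _ _ (fun m => ha m l) (fun m => ha1 m l)
            (fun y => hb y l) (fun y => hb1 y l)
      _ = _ := by rw [← Finset.sum_mul, hw1, one_mul]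
end

section
/- (Theorem 1.) For a k-regular output-uniform classical channel with uniform message prior, every behavior p that is no-signalling to Alice satisfies: S(p) > S_Cl^max if and only if S_Bell(p) > S_local^max, where S_local^max := sup { S_Bell(q) : q a Bell-local behavior }. That is, the behavior provides an advantage over the classical value in the one-shot communication task exactly when it provides an advantage over the Bell-local value in the corresponding nonlocal game. -/
open Finset

lemma oneShotS_eq_sum {X Y Msg : Type*} [Fintype X] [Fintype Y] [Fintype Msg]
    (N : X → Y → ℝ) (k : ℕ) (hunif : ∀ x y, N x y ≠ 0 → N x y = 1 / (k : ℝ))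
    (p : Msg → Y → X → Msg → ℝ) :
    oneShotS N k p = (1 / (Fintype.card Msg : ℝ)) * ∑ m, ∑ x, ∑ y, N x y * p m y x m := by
  unfold oneShotS
  congr 1
  refine Finset.sum_congr rfl fun m _ => Finset.sum_congr rfl fun x _ => ?_
  rw [Finset.sum_filter]
  refine Finset.sum_congr rfl fun y _ => ?_
  split_ifs with h
  · rw [hunif x y h]
  · rw [not_not.mp h, zero_mul]

/-- For behaviors that are no-signalling to Alice, the game value is an affine function of the
one-shot success probability. -/
lemma sBell_eq_affine_oneShotS {X Y Msg : Type*} [Fintype X] [Fintype Y] [Fintype Msg]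
    [Nonempty Y] [Nonempty Msg] [DecidableEq Msg]
    (N : X → Y → ℝ) (k : ℕ) (hk1 : 1 ≤ k)
    (hreg : ∀ x, (Finset.univ.filter (fun y => N x y ≠ 0)).card = k)
    (p : Msg → Y → X → Msg → ℝ)
    (hpsum : ∀ m y, ∑ x, ∑ m', p m y x m' = 1)
    (hns : ∀ x m y y'', ∑ m', p m y x m' = ∑ m', p m y'' x m') :
    sBell N p = 1 - k / Fintype.card Y + k / Fintype.card Y * oneShotS N k p := by
  have hk : (k : ℝ) ≠ 0 := by positivity
  have hY : (Fintype.card Y : ℝ) ≠ 0 := by simp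
  have hM : (Fintype.card Msg : ℝ) ≠ 0 := by simp
  have inner (x : X) (m : Msg) (y : Y) : ∑ m', p m y x m' * gameV N x m' m y =
      ∑ m', p m y x m' - (if N x y ≠ 0 then ∑ m', p m y x m' else 0)
        + (if N x y ≠ 0 then p m y x m else 0) := by
    unfold gameV
    split_ifs <;> simp
  have total : ∑ m, ∑ x, ∑ y, ∑ m', p m y x m' = (Fintype.card Msg : ℝ) * Fintype.card Y := by
    calc ∑ m, ∑ x, ∑ y, ∑ m', p m y x m' = ∑ m : Msg, ∑ y : Y, (1 : ℝ) :=
          Finset.sum_congr rfl fun m _ => by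
            rw [Finset.sum_comm]
            exact Finset.sum_congr rfl fun y _ => hpsum m y
      _ = _ := by simp
  have onSupport : ∑ m, ∑ x, ∑ y, (if N x y ≠ 0 then ∑ m', p m y x m' else 0)
      = (Fintype.card Msg : ℝ) * k := by
    obtain ⟨y₀⟩ := ‹Nonempty Y›
    calc ∑ m, ∑ x, ∑ y, (if N x y ≠ 0 then ∑ m', p m y x m' else 0)
        = ∑ m, ∑ x, (k : ℝ) * ∑ m', p m y₀ x m' := by
          refine Finset.sum_congr rfl fun m _ => Finset.sum_congr rfl fun x _ => ?_
          rw [← Finset.sum_filter, Finset.sum_congr rfl fun y _ => hns x m y y₀,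
            Finset.sum_const, hreg, nsmul_eq_mul]
      _ = _ := by simp [← Finset.mul_sum, hpsum]
  have game : ∑ x, ∑ m', ∑ m, ∑ y, p m y x m' * gameV N x m' m y =
      ∑ m, ∑ x, ∑ y, ∑ m', p m y x m' * gameV N x m' m y := by
    rw [Finset.sum_comm (s := (Finset.univ : Finset Msg)) (t := (Finset.univ : Finset X))]
    refine Finset.sum_congr rfl fun x _ => ?_
    rw [Finset.sum_comm]
    exact Finset.sum_congr rfl fun m _ => Finset.sum_comm
  have success : ∑ m, ∑ x, ∑ y, (if N x y ≠ 0 then p m y x m else 0)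
      = (Fintype.card Msg : ℝ) * k * oneShotS N k p := by
    unfold oneShotS
    simp_rw [← Finset.mul_sum, Finset.sum_filter]
    field_simp
  unfold sBell
  rw [game]
  simp_rw [inner, Finset.sum_add_distrib, Finset.sum_sub_distrib]
  rw [total, onSupport, success]
  field_simp

lemma sum_mul_le_of_forall_le {ι : Type*} [Fintype ι] {u v : ι → ℝ} {c : ℝ}
    (hu : ∀ i, 0 ≤ u i) (hu1 : ∑ i, u i = 1) (hv : ∀ i, v i ≤ c) : ∑ i, u i * v i ≤ c :=
  calc ∑ i, u i * v i ≤ ∑ i, u i * c :=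
        Finset.sum_le_sum fun i _ => mul_le_mul_of_nonneg_left (hv i) (hu i)
    _ = c := by rw [← Finset.sum_mul, hu1, one_mul]

/-- Local randomness does not help: stochastic encodings and decodings are no better than
deterministic ones. -/
lemma stochastic_le_sClMax {X Y Msg : Type*} [Fintype X] [Fintype Y] [Fintype Msg]
    [Nonempty X] [Nonempty Y] [Nonempty Msg] [DecidableEq Msg] [DecidableEq Y]
    (N : X → Y → ℝ) {a : Msg → X → ℝ} {b : Y → Msg → ℝ}
    (ha : ∀ m x, 0 ≤ a m x) (ha1 : ∀ m, ∑ x, a m x = 1)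
    (hb : ∀ y m, 0 ≤ b y m) (hb1 : ∀ y, ∑ m, b y m = 1) :
    (1 / (Fintype.card Msg : ℝ)) * ∑ m, ∑ x, a m x * ∑ y, N x y * b y m
      ≤ sClMax (Msg := Msg) N := by
  choose f hf using fun m => Finite.exists_max fun x => ∑ y, N x y * b y m
  choose g hg using fun y => Finite.exists_max fun m => N (f m) y
  refine le_trans ?_ (Finset.le_sup' _ (Finset.mem_univ (f, g)))
  refine mul_le_mul_of_nonneg_left ?_ (by positivity)
  calc ∑ m, ∑ x, a m x * ∑ y, N x y * b y m
      ≤ ∑ m, ∑ y, N (f m) y * b y m :=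
        Finset.sum_le_sum fun m _ => sum_mul_le_of_forall_le (ha m) (ha1 m) (hf m)
    _ = ∑ y, ∑ m, b y m * N (f m) y := by
        rw [Finset.sum_comm]
        simp_rw [mul_comm]
    _ ≤ ∑ y, N (f (g y)) y :=
        Finset.sum_le_sum fun y _ => sum_mul_le_of_forall_le (hb y) (hb1 y) (hg y)
    _ = ∑ m, ∑ y, N (f m) y * (if g y = m then (1 : ℝ) else 0) := by
        rw [Finset.sum_comm]
        simp

namespace BellLocal

variable {X Y Msg : Type*} [Fintype X] [Fintype Y] [Fintype Msg] {q : Msg → Y → X → Msg → ℝ}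

lemma noSignalling (hq : BellLocal q) (x : X) (m : Msg) (y y' : Y) :
    ∑ m', q m y x m' = ∑ m', q m y' x m' := by
  obtain ⟨n, w, a, b, -, -, -, -, -, hb1, hq⟩ := hq
  have marginal (y : Y) : ∑ m', q m y x m' = ∑ l, w l * a m l x := by
    simp_rw [hq]
    rw [Finset.sum_comm]
    simp_rw [← Finset.mul_sum, hb1, mul_one]
  rw [marginal, marginal]

lemma sum_eq_one (hq : BellLocal q) (m : Msg) (y : Y) : ∑ x, ∑ m', q m y x m' = 1 := by
  obtain ⟨n, w, a, b, -, hw1, -, ha1, -, hb1, hq⟩ := hq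
  calc ∑ x, ∑ m', q m y x m' = ∑ x, ∑ l, w l * a m l x :=
        Finset.sum_congr rfl fun x _ => by
          simp_rw [hq]
          rw [Finset.sum_comm]
          simp_rw [← Finset.mul_sum, hb1, mul_one]
    _ = 1 := by
        rw [Finset.sum_comm]
        simp_rw [← Finset.mul_sum, ha1, mul_one, hw1]

lemma oneShotS_le_sClMax [Nonempty X] [Nonempty Y] [Nonempty Msg] [DecidableEq Msg]
    [DecidableEq Y] (hq : BellLocal q) (N : X → Y → ℝ) (k : ℕ)
    (hunif : ∀ x y, N x y ≠ 0 → N x y = 1 / (k : ℝ)) :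
    oneShotS N k q ≤ sClMax (Msg := Msg) N := by
  obtain ⟨n, w, a, b, hw, hw1, ha, ha1, hb, hb1, hq⟩ := hq
  have mix : oneShotS N k q = ∑ l, w l * ((1 / (Fintype.card Msg : ℝ)) *
      ∑ m, ∑ x, a m l x * ∑ y, N x y * b y l m) := by
    rw [oneShotS_eq_sum N k hunif]
    simp_rw [hq, Finset.mul_sum]
    rw [Finset.sum_comm (s := (Finset.univ : Finset (Fin n)))]
    refine Finset.sum_congr rfl fun m _ => ?_
    rw [Finset.sum_comm (s := (Finset.univ : Finset (Fin n)))]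
    refine Finset.sum_congr rfl fun x _ => ?_
    rw [Finset.sum_comm (s := (Finset.univ : Finset (Fin n)))]
    exact Finset.sum_congr rfl fun y _ => Finset.sum_congr rfl fun l _ => by ring
  rw [mix]
  exact sum_mul_le_of_forall_le hw hw1 fun l =>
    stochastic_le_sClMax N (fun m => ha m l) (fun m => ha1 m l) (fun y => hb y l)
      (fun y => hb1 y l)

end BellLocal

/-- Some deterministic, hence Bell-local, behavior attains the classical value. -/
lemma exists_bellLocal_oneShotS_eq_sClMax {X Y Msg : Type*} [Fintype X] [Fintype Y] [Fintype Msg]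
    [Nonempty X] [Nonempty Y] [Nonempty Msg] [DecidableEq Msg] [DecidableEq Y]
    (N : X → Y → ℝ) (k : ℕ) (hunif : ∀ x y, N x y ≠ 0 → N x y = 1 / (k : ℝ)) :
    ∃ q : Msg → Y → X → Msg → ℝ, BellLocal q ∧ oneShotS N k q = sClMax (Msg := Msg) N := by
  classical
  obtain ⟨⟨f, g⟩, -, hfg⟩ := Finset.exists_mem_eq_sup' (Finset.univ_nonempty)
    (fun fg : (Msg → X) × (Y → Msg) => (1 / (Fintype.card Msg : ℝ)) *
        ∑ m, ∑ y, N (fg.1 m) y * (if fg.2 y = m then (1 : ℝ) else 0))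
  refine ⟨fun m y x m' => (if f m = x then 1 else 0) * (if g y = m' then 1 else 0),
    ⟨1, fun _ => 1, fun m _ x => if f m = x then 1 else 0,
      fun y _ m' => if g y = m' then 1 else 0, by simp, by simp, ?_, by simp, ?_, by simp,
      by simp⟩, ?_⟩
  · intro m _ x
    positivity
  · intro y _ m'
    positivity
  · rw [oneShotS_eq_sum N k hunif]
    refine Eq.trans ?_ hfg.symm
    congr 1
    refine Finset.sum_congr rfl fun m _ => ?_
    rw [Finset.sum_comm]
    refine Finset.sum_congr rfl fun y _ => ?_
    rw [Finset.sum_eq_single (f m)] <;> aesop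

/-- Theorem 1: for a `k`-regular output-uniform classical
channel with uniform message prior, a behavior no-signalling to Alice gives a
quantum advantage in the one-shot communication task iff it gives an advantage
in the corresponding nonlocal game:
`S(p) > S_Cl^max ↔ S_Bell(p) > S_local^max`. -/
theorem oneShot_advantage_iff_game_advantage
    {X Y Msg : Type*} [Fintype X] [Fintype Y] [Fintype Msg]
    [Nonempty X] [Nonempty Y] [Nonempty Msg] [DecidableEq Msg] [DecidableEq Y]
    (N : X → Y → ℝ) (hN : ∀ x y, 0 ≤ N x y) (hNsum : ∀ x, ∑ y, N x y = 1)
    (k : ℕ) (hk1 : 1 ≤ k) (hkY : k ≤ Fintype.card Y)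
    (hreg : ∀ x, (Finset.univ.filter (fun y => N x y ≠ 0)).card = k)
    (hunif : ∀ x y, N x y ≠ 0 → N x y = 1 / (k : ℝ))
    (p : Msg → Y → X → Msg → ℝ)
    (hp : ∀ m y x m', 0 ≤ p m y x m')
    (hpsum : ∀ m y, ∑ x, ∑ m', p m y x m' = 1)
    (hns : ∀ x m y y'', ∑ m', p m y x m' = ∑ m', p m y'' x m') :
    oneShotS N k p > sClMax (Msg := Msg) N ↔
      sBell N p >
        sSup {s : ℝ | ∃ q : Msg → Y → X → Msg → ℝ, BellLocal q ∧ s = sBell N q} := by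
  have hc : 0 < (k : ℝ) / Fintype.card Y := by
    have : 0 < Fintype.card Y := Fintype.card_pos
    positivity
  have affine {q : Msg → Y → X → Msg → ℝ} (hq : BellLocal q) :=
    sBell_eq_affine_oneShotS N k hk1 hreg q hq.sum_eq_one hq.noSignalling
  obtain ⟨q₀, hq₀, hS₀⟩ := exists_bellLocal_oneShotS_eq_sClMax (Msg := Msg) N k hunif
  have localMax : IsGreatest
      {s : ℝ | ∃ q : Msg → Y → X → Msg → ℝ, BellLocal q ∧ s = sBell N q}
      (1 - k / Fintype.card Y + k / Fintype.card Y * sClMax (Msg := Msg) N) := by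
    refine ⟨⟨q₀, hq₀, by rw [affine hq₀, hS₀]⟩, ?_⟩
    rintro _ ⟨q, hq, rfl⟩
    rw [affine hq]
    have := hq.oneShotS_le_sClMax N k hunif
    gcongr
  rw [localMax.csSup_eq, sBell_eq_affine_oneShotS N k hk1 hreg p hpsum hns, gt_iff_lt, gt_iff_lt,
    add_lt_add_iff_left, mul_lt_mul_iff_right₀ hc]
end

section
/- Let Msg be a finite nonempty set with prior π, and for each m ∈ Msg let X_m be a finite nonempty set. Let Λ be a finite set with a probability distribution ν. Suppose for each m ∈ Msg and λ ∈ Λ: ξ(·|m,λ) : X_m → [0,1] with ∑_{x∈X_m} ξ(x|m,λ) = 1, and μ(·|m,λ) a probability distribution on X_m. Let η be a function on pairs with η(x,x) = 1 for all x, and 0 ≤ η(x,x') ≤ η_max for all distinct x,x' ∈ X_m and all m, where 0 ≤ η_max ≤ 1. Define S := ∑_{λ} ν(λ) ∑_m π(m) ∑_{x,x'∈X_m} ξ(x'|m,λ)·μ(x|m,λ)·η(x,x') and the weighted max-predictability β := max_{λ∈Λ} ∑_m π(m) max_{x∈X_m} ξ(x|m,λ). Then S ≤ η_max + (1 − η_max)·β.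 -/
/-- A convex combination of values bounded by `c` is bounded by `c`. -/
theorem weighted_sum_le_of_forall_le {ι : Type*} {s : Finset ι} {w f : ι → ℝ} {c : ℝ}
    (hw : ∀ i ∈ s, 0 ≤ w i) (hsum : ∑ i ∈ s, w i = 1) (hf : ∀ i ∈ s, f i ≤ c) :
    ∑ i ∈ s, w i * f i ≤ c :=
  calc ∑ i ∈ s, w i * f i ≤ ∑ i ∈ s, w i * c :=
        Finset.sum_le_sum fun i hi => mul_le_mul_of_nonneg_left (hf i hi) (hw i hi)
    _ = c := by rw [← Finset.sum_mul, hsum, one_mul]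

/-- If `g` is `1` at `a` and at most `c` elsewhere on `s`, its average against the weights `w`
is at most `c + (1 - c) * w a`. -/
theorem weighted_sum_le_of_eq_one_of_forall_ne_le {ι : Type*} {s : Finset ι} {w g : ι → ℝ}
    {c : ℝ} {a : ι} (ha : a ∈ s) (hw : ∀ i ∈ s, 0 ≤ w i) (hsum : ∑ i ∈ s, w i = 1)
    (hga : g a = 1) (hg : ∀ i ∈ s, a ≠ i → g i ≤ c) :
    ∑ i ∈ s, w i * g i ≤ c + (1 - c) * w a := by
  classical
  calc ∑ i ∈ s, w i * g i ≤ ∑ i ∈ s, (w i * c + if a = i then (1 - c) * w i else 0) := by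
        refine Finset.sum_le_sum fun i hi => ?_
        split_ifs with h
        · subst h
          rw [hga]
          linarith
        · simpa using mul_le_mul_of_nonneg_left (hg i hi h) (hw i hi)
    _ = c + (1 - c) * w a := by
        rw [Finset.sum_add_distrib, ← Finset.sum_mul, hsum, one_mul, Finset.sum_ite_eq, if_pos ha]

/-- Appendix E: the one-shot success probability of any
noncontextual ontological model is bounded by
`S ≤ η_max + (1 - η_max) β`, where
`β = max_λ ∑_m π(m) max_{x∈X_m} ξ(x|m,λ)` is the weighted max-predictability. -/
theorem noncontextual_success_le_weighted_max_predictability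
    {X Msg Λ : Type*} [Fintype X] [Fintype Msg] [Fintype Λ]
    [Nonempty Msg] [Nonempty Λ]
    (π : Msg → ℝ) (hπ : ∀ m, 0 ≤ π m) (hπsum : ∑ m, π m = 1)
    (Xm : Msg → Finset X) (hXmne : ∀ m, (Xm m).Nonempty)
    (ν : Λ → ℝ) (hν0 : ∀ l, 0 ≤ ν l) (hνsum : ∑ l, ν l = 1)
    (ξ : Msg → Λ → X → ℝ)
    (hξ0 : ∀ m l, ∀ x ∈ Xm m, 0 ≤ ξ m l x)
    (hξ1 : ∀ m l, ∀ x ∈ Xm m, ξ m l x ≤ 1)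
    (hξsum : ∀ m l, ∑ x ∈ Xm m, ξ m l x = 1)
    (μ : Msg → Λ → X → ℝ)
    (hμ0 : ∀ m l, ∀ x ∈ Xm m, 0 ≤ μ m l x)
    (hμsum : ∀ m l, ∑ x ∈ Xm m, μ m l x = 1)
    (η : X → X → ℝ) (ηmax : ℝ) (h0 : 0 ≤ ηmax) (h1 : ηmax ≤ 1)
    (hηdiag : ∀ x, η x x = 1)
    (hηbound : ∀ m, ∀ x ∈ Xm m, ∀ x' ∈ Xm m, x ≠ x' →
      0 ≤ η x x' ∧ η x x' ≤ ηmax) :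
    (∑ l, ν l * ∑ m, π m * ∑ x ∈ Xm m, ∑ x' ∈ Xm m,
        ξ m l x' * μ m l x * η x x')
      ≤ ηmax + (1 - ηmax) *
          (Finset.univ.sup' Finset.univ_nonempty
            (fun l : Λ => ∑ m, π m * (Xm m).sup' (hXmne m) (fun x => ξ m l x))) := by
  have h_inner : ∀ m l, ∑ x ∈ Xm m, ∑ x' ∈ Xm m, ξ m l x' * μ m l x * η x x'
      ≤ ηmax + (1 - ηmax) * (Xm m).sup' (hXmne m) (fun x => ξ m l x) := by
    intro m l
    have h_factor : ∀ x, ∑ x' ∈ Xm m, ξ m l x' * μ m l x * η x x'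
        = μ m l x * ∑ x' ∈ Xm m, ξ m l x' * η x x' := fun x => by
      rw [Finset.mul_sum]
      exact Finset.sum_congr rfl fun x' _ => by ring
    simp_rw [h_factor]
    refine weighted_sum_le_of_forall_le (hμ0 m l) (hμsum m l) fun x hx => ?_
    refine (weighted_sum_le_of_eq_one_of_forall_ne_le hx (hξ0 m l) (hξsum m l) (hηdiag x)
      fun x' hx' hne => (hηbound m x hx x' hx' hne).2).trans ?_
    gcongr
    exact Finset.le_sup' (fun x => ξ m l x) hx
  refine weighted_sum_le_of_forall_le (fun l _ => hν0 l) hνsum fun l _ => ?_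
  calc ∑ m, π m * ∑ x ∈ Xm m, ∑ x' ∈ Xm m, ξ m l x' * μ m l x * η x x'
      ≤ ∑ m, π m * (ηmax + (1 - ηmax) * (Xm m).sup' (hXmne m) (fun x => ξ m l x)) :=
        Finset.sum_le_sum fun m _ => mul_le_mul_of_nonneg_left (h_inner m l) (hπ m)
    _ = ηmax + (1 - ηmax) * ∑ m, π m * (Xm m).sup' (hXmne m) (fun x => ξ m l x) := by
        simp_rw [mul_add, Finset.sum_add_distrib, ← Finset.sum_mul, hπsum, one_mul,
          mul_left_comm _ (1 - ηmax), ← Finset.mul_sum]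
    _ ≤ _ := by
        gcongr
        exact Finset.le_sup'
          (fun l : Λ => ∑ m, π m * (Xm m).sup' (hXmne m) (fun x => ξ m l x)) (Finset.mem_univ l)
end

section
/- In the Prevedel et al. protocol, if the underlying correlation q(b₂,z|m,v) is Bell-local — i.e., there exist a finite set Λ, a probability distribution w on Λ, and functions α(b₂|m,λ) ≥ 0 with ∑_{b₂} α(b₂|m,λ) = 1 and β(z|v,λ) ≥ 0 with ∑_z β(z|v,λ) = 1, such that q(b₂,z|m,v) = ∑_{λ∈Λ} w(λ)·α(b₂|m,λ)·β(z|v,λ) — then the one-shot success probability satisfies S ≤ 5/6. -/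
/-- The CHSH inequality for response probabilities `a₀, a₁` and `c₀, c₁` of the outcome `0`. -/
theorem chsh_le_three {a₀ a₁ c₀ c₁ : ℝ} (ha₀ : 0 ≤ a₀) (ha₀' : a₀ ≤ 1) (ha₁ : 0 ≤ a₁)
    (ha₁' : a₁ ≤ 1) (hc₀ : 0 ≤ c₀) (hc₀' : c₀ ≤ 1) (hc₁ : 0 ≤ c₁) (hc₁' : c₁ ≤ 1) :
    (a₀ * c₀ + (1 - a₀) * (1 - c₀)) + (a₁ * c₀ + (1 - a₁) * (1 - c₀))
      + (a₀ * c₁ + (1 - a₀) * (1 - c₁)) + (a₁ * (1 - c₁) + (1 - a₁) * c₁) ≤ 3 := by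
  have mul_le_abs (x y : ℝ) (hy : |y| ≤ 1) : x * y ≤ |x| :=
    (le_abs_self _).trans <| by
      rw [abs_mul]
      exact mul_le_of_le_one_right (abs_nonneg x) hy
  have h₀ := mul_le_abs (1 - a₀ - a₁) (1 - 2 * c₀) (abs_le.2 ⟨by linarith, by linarith⟩)
  have h₁ := mul_le_abs (a₀ - a₁) (2 * c₁ - 1) (abs_le.2 ⟨by linarith, by linarith⟩)
  have h : |1 - a₀ - a₁| + |a₀ - a₁| ≤ 1 := by
    rcases abs_cases (1 - a₀ - a₁) with h | h <;> rcases abs_cases (a₀ - a₁) with h' | h' <;>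
      linarith
  linarith

/-- Prevedel et al. protocol: if the underlying correlation
`q` is Bell-local, then the one-shot success probability satisfies `S ≤ 5/6`.
Here `q m v b z` denotes q(b₂,z|m,v), with all indices in `Fin 2` and `+`
addition mod 2. -/
theorem prevedel_bell_local_success_le
    (q : Fin 2 → Fin 2 → Fin 2 → Fin 2 → ℝ)
    (hq0 : ∀ m v b z, 0 ≤ q m v b z)
    (hqsum : ∀ m v, ∑ b, ∑ z, q m v b z = 1)
    (qA : Fin 2 → Fin 2 → ℝ)
    (hqA : ∀ m v b, ∑ z, q m v b z = qA m b)
    (hlocal : ∃ (n : ℕ) (w : Fin n → ℝ) (α : Fin 2 → Fin n → Fin 2 → ℝ)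
        (β : Fin 2 → Fin n → Fin 2 → ℝ),
        (∀ l, 0 ≤ w l) ∧ (∑ l, w l = 1) ∧
        (∀ m l b, 0 ≤ α m l b) ∧ (∀ m l, ∑ b, α m l b = 1) ∧
        (∀ v l z, 0 ≤ β v l z) ∧ (∀ v l, ∑ z, β v l z = 1) ∧
        (∀ m v b z, q m v b z = ∑ l, w l * α m l b * β v l z)) :
    (∑ m, ∑ b, (1 / 2 : ℝ) * (1 / 3) * qA m b)
        + (∑ m, ∑ b, ∑ z, (1 / 2 : ℝ) * (1 / 3) * q m 1 b z
            * (if b + z = m then 1 else 0))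
        + (∑ m, ∑ b, ∑ z, (1 / 2 : ℝ) * (1 / 3) * q m 0 b z
            * (if b + z = 0 then 1 else 0))
      ≤ 5 / 6 := by
  obtain ⟨n, w, α, β, hw, hwsum, hα, hαsum, hβ, hβsum, hq⟩ := hlocal
  have hA (m : Fin 2) : ∑ b, qA m b = 1 := by
    simp_rw [← hqA m 0, hqsum]
  have chsh : (q 0 0 0 0 + q 0 0 1 1) + (q 1 0 0 0 + q 1 0 1 1)
      + (q 0 1 0 0 + q 0 1 1 1) + (q 1 1 0 1 + q 1 1 1 0) ≤ 3 := by
    calc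
      _ = ∑ l, w l * ((α 0 l 0 * β 0 l 0 + α 0 l 1 * β 0 l 1)
          + (α 1 l 0 * β 0 l 0 + α 1 l 1 * β 0 l 1)
          + (α 0 l 0 * β 1 l 0 + α 0 l 1 * β 1 l 1)
          + (α 1 l 0 * β 1 l 1 + α 1 l 1 * β 1 l 0)) := by
        simp only [hq, ← Finset.sum_add_distrib]
        exact Finset.sum_congr rfl fun l _ => by ring
      _ ≤ ∑ l, w l * 3 := by
        refine Finset.sum_le_sum fun l _ => mul_le_mul_of_nonneg_left ?_ (hw l)
        simp only [Fin.sum_univ_two] at hαsum hβsum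
        have hα₁ (m : Fin 2) : α m l 1 = 1 - α m l 0 := by linarith [hαsum m l]
        have hβ₁ (v : Fin 2) : β v l 1 = 1 - β v l 0 := by linarith [hβsum v l]
        have hα_le (m : Fin 2) : α m l 0 ≤ 1 := by linarith [hαsum m l, hα m l 1]
        have hβ_le (v : Fin 2) : β v l 0 ≤ 1 := by linarith [hβsum v l, hβ v l 1]
        simp only [hα₁, hβ₁]
        exact chsh_le_three (hα 0 l 0) (hα_le 0) (hα 1 l 0) (hα_le 1)
          (hβ 0 l 0) (hβ_le 0) (hβ 1 l 0) (hβ_le 1)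
      _ = 3 := by rw [← Finset.sum_mul, hwsum, one_mul]
  have hA₀ := hA 0
  have hA₁ := hA 1
  have one_add_one : (1 : Fin 2) + 1 = 0 := rfl
  simp only [Fin.sum_univ_two] at hA₀ hA₁
  simp [Fin.sum_univ_two, one_add_one]
  linarith
end

section
/- For the completed 55-vector Conway–Kochen set with its 41 complete orthogonal bases, the maximum cardinality of a pairwise-disjoint subfamily of the 41 bases is exactly 13: there exist 13 of the bases that are pairwise disjoint as index sets, and any subfamily of 14 or more of the bases contains two bases sharing an index. -/
/-- The 41 complete orthogonal bases of the completed 55-vector Conway–Kochen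
set, as index triples in `Fin 55` (0-indexed: the paper's basis `{i,j,k}` is
`{i-1, j-1, k-1}` here). -/
def ckBases41 : Finset (Finset (Fin 55)) :=
  {{0, 11, 29},
     {1, 15, 20},
     {2, 13, 22},
     {3, 26, 28},
     {4, 14, 21},
     {4, 15, 22},
     {4, 26, 29},
     {5, 26, 30},
     {6, 17, 22},
     {7, 15, 24},
     {8, 27, 29},
     {9, 18, 22},
     {9, 23, 28},
     {10, 12, 27},
     {10, 15, 25},
     {11, 16, 25},
     {18, 19, 30},
     {0, 13, 46},
     {0, 20, 49},
     {1, 19, 45},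
     {2, 12, 32},
     {3, 17, 35},
     {3, 20, 44},
     {5, 13, 47},
     {5, 24, 38},
     {6, 16, 40},
     {7, 23, 43},
     {8, 17, 41},
     {8, 24, 34},
     {9, 27, 39},
     {10, 30, 31},
     {11, 18, 48},
     {12, 21, 36},
     {14, 19, 50},
     {14, 23, 42},
     {16, 21, 37},
     {25, 28, 33},
     {1, 39, 53},
     {2, 33, 52},
     {6, 31, 51},
     {7, 48, 54}}

/-- Weight duality for set packings: if every member of a pairwise disjoint family weighs at
least `D`, then the total weight is at least `D` times the size of the family. -/
theorem mul_card_le_sum_of_pairwiseDisjoint {α : Type*} [Fintype α] [DecidableEq α]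
    {F : Finset (Finset α)} (hF : (F : Set (Finset α)).PairwiseDisjoint id) (w : α → ℕ) (D : ℕ)
    (hw : ∀ B ∈ F, D ≤ ∑ x ∈ B, w x) : D * F.card ≤ ∑ x, w x :=
  calc D * F.card = ∑ _B ∈ F, D := by rw [Finset.sum_const, smul_eq_mul, mul_comm]
    _ ≤ ∑ B ∈ F, ∑ x ∈ B, w x := Finset.sum_le_sum hw
    _ = ∑ x ∈ F.biUnion id, w x := (Finset.sum_biUnion hF).symm
    _ ≤ ∑ x, w x := Finset.sum_le_sum_of_subset (Finset.subset_univ _)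

/-- Weight duality for the members of a packing `F` outside a subfamily `K`: these members are
disjoint from all of `K`. -/
theorem mul_card_sub_card_le_sum_of_pairwiseDisjoint {α : Type*} [Fintype α] [DecidableEq α]
    {F K : Finset (Finset α)} (hF : (F : Set (Finset α)).PairwiseDisjoint id) (hKF : K ⊆ F)
    (w : α → ℕ) (D : ℕ) (hw : ∀ B ∈ F, (∀ C ∈ K, Disjoint C B) → D ≤ ∑ x ∈ B, w x) :
    D * (F.card - K.card) ≤ ∑ x, w x := by
  rw [← Finset.card_sdiff_of_subset hKF]
  refine mul_card_le_sum_of_pairwiseDisjoint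
    (hF.subset (Finset.coe_subset.2 Finset.sdiff_subset)) w D fun B hB ↦ ?_
  obtain ⟨hBF, hBK⟩ := Finset.mem_sdiff.1 hB
  exact hw B hBF fun C hC ↦ hF (hKF hC) hBF fun h ↦ hBK (h ▸ hC)

/-- A pairwise disjoint family of the bases has at most 13 members. The linear programming bound
is `43 / 3`, so we branch on the membership of two bases. -/
theorem card_le_of_subset_ckBases41 {F : Finset (Finset (Fin 55))} (hF : F ⊆ ckBases41)
    (hd : (F : Set (Finset (Fin 55))).PairwiseDisjoint id) : F.card ≤ 13 := by
  by_cases h₁ : {4, 26, 29} ∈ F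
  · by_cases h₂ : {9, 18, 22} ∈ F
    · obtain ⟨w, hw, hsum⟩ : ∃ w : Fin 55 → ℕ, (∀ B ∈ ckBases41, Disjoint {4, 26, 29} B →
          Disjoint {9, 18, 22} B → 2 ≤ ∑ x ∈ B, w x) ∧ ∑ x, w x = 23 := by
        refine ⟨
          ![0, 2, 1, 0, 0, 0, 1, 2, 0, 0, 1, 0, 1, 2, 2, 0, 1, 2, 0, 0, 2, 1, 0, 0, 2, 1, 0, 0,
            0, 0, 0, 1, 0, 1, 0, 0, 0, 0, 0, 0, 0, 0, 0, 0, 0, 0, 0, 0, 0, 0, 0, 0, 0, 0, 0],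
          ?_, by decide +kernel⟩
        simp only [ckBases41, Finset.forall_mem_insert, Finset.mem_singleton, forall_eq]
        and_intros <;> decide
      have h := mul_card_sub_card_le_sum_of_pairwiseDisjoint (K := {{4, 26, 29}, {9, 18, 22}}) hd
        (by simp [Finset.insert_subset_iff, h₁, h₂]) w 2 fun B hB hK ↦
          hw B (hF hB) (hK _ (by simp)) (hK _ (by simp))
      rw [hsum, Finset.card_pair (by decide)] at h
      lia
    · obtain ⟨w, hw, hsum⟩ : ∃ w : Fin 55 → ℕ, (∀ B ∈ ckBases41, B ≠ {9, 18, 22} →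
          Disjoint {4, 26, 29} B → 2 ≤ ∑ x ∈ B, w x) ∧ ∑ x, w x = 25 := by
        refine ⟨
          ![0, 0, 1, 0, 0, 0, 1, 0, 0, 0, 1, 0, 1, 2, 0, 0, 1, 2, 0, 2, 2, 1, 0, 2, 2, 1, 0, 0,
            0, 0, 0, 1, 0, 1, 0, 0, 0, 0, 0, 2, 0, 0, 0, 0, 0, 0, 0, 0, 2, 0, 0, 0, 0, 0, 0],
          ?_, by decide +kernel⟩
        simp only [ckBases41, Finset.forall_mem_insert, Finset.mem_singleton, forall_eq]
        and_intros <;> decide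
      have h := mul_card_sub_card_le_sum_of_pairwiseDisjoint (K := {{4, 26, 29}}) hd
        (by simpa using h₁) w 2 fun B hB hK ↦
          hw B (hF hB) (ne_of_mem_of_not_mem hB h₂) (hK _ (by simp))
      rw [hsum, Finset.card_singleton] at h
      lia
  · obtain ⟨w, hw, hsum⟩ : ∃ w : Fin 55 → ℕ,
        (∀ B ∈ ckBases41, B ≠ {4, 26, 29} → 7 ≤ ∑ x ∈ B, w x) ∧ ∑ x, w x = 97 := by
      refine ⟨
        ![6, 3, 3, 6, 1, 6, 3, 3, 6, 2, 2, 1, 4, 1, 3, 3, 4, 1, 2, 4, 1, 3, 3, 4, 1, 2, 0, 1, 1,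
          0, 1, 4, 0, 4, 0, 0, 0, 0, 0, 4, 0, 0, 0, 0, 0, 0, 0, 0, 4, 0, 0, 0, 0, 0, 0],
        ?_, by decide +kernel⟩
      simp only [ckBases41, Finset.forall_mem_insert, Finset.mem_singleton, forall_eq]
      and_intros <;> decide
    have h := mul_card_le_sum_of_pairwiseDisjoint hd w 7 fun B hB ↦
      hw B (hF hB) (ne_of_mem_of_not_mem hB h₁)
    lia

/-- the maximum cardinality of a pairwise-disjoint subfamily
of the 41 bases of the completed 55-vector Conway–Kochen set is exactly 13. -/
theorem conwayKochen55_max_disjoint_bases :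
    (∃ F : Finset (Finset (Fin 55)), F ⊆ ckBases41 ∧ F.card = 13 ∧
      ∀ B ∈ F, ∀ B' ∈ F, B ≠ B' → Disjoint B B') ∧
    (∀ F : Finset (Finset (Fin 55)), F ⊆ ckBases41 → 14 ≤ F.card →
      ∃ B ∈ F, ∃ B' ∈ F, B ≠ B' ∧ ¬ Disjoint B B') := by
  constructor
  · refine ⟨{{0, 11, 29}, {1, 15, 20}, {18, 19, 30}, {2, 12, 32}, {3, 17, 35}, {5, 13, 47},
      {8, 24, 34}, {9, 27, 39}, {14, 23, 42}, {16, 21, 37}, {25, 28, 33}, {6, 31, 51},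
      {7, 48, 54}}, by decide +kernel, by decide +kernel, ?_⟩
    simp only [Finset.forall_mem_insert, Finset.mem_singleton, forall_eq]
    and_intros <;> decide
  · intro F hF hcard
    by_contra! h
    have := card_le_of_subset_ckBases41 hF fun B hB B' hB' hne ↦ h B hB B' hB' hne
    lia
end
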